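/- Let f ∈ C²[0,1]. Then for all natural numbers n ≥ 2, ‖B_n f − f − (1/(2n))·φ²·f″‖ ≤ (5/(8n))·ω₁(f″, 1/√n) + (13/(64n))·ω₂(f″, 1/√n). -/

import Mathlib

open Real Set Filter

/-- `φ(x) = √(x(1-x))`. -/
noncomputable def phi (x : ℝ) : ℝ := Real.sqrt (x * (1 - x))

/-- The Bernstein operator `B_n(f;x) = ∑_{k=0}^n f(k/n) C(n,k) x^k (1-x)^{n-k}`. -/
noncomputable def bern (n : ℕ) (f : ℝ → ℝ) (x : ℝ) : ℝ :=
  ∑ k ∈ Finset.range (n + 1),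
    f ((k : ℝ) / (n : ℝ)) * (n.choose k : ℝ) * x ^ k * (1 - x) ^ (n - k)

/-- The sup norm on `[0,1]`. -/
noncomputable def supNorm (g : ℝ → ℝ) : ℝ := sSup ((fun x => |g x|) '' Set.Icc 0 1)

/-- The second order Ditzian–Totik modulus of smoothness. -/
noncomputable def omega2phi (f : ℝ → ℝ) (δ : ℝ) : ℝ :=
  sSup {y : ℝ | ∃ h ∈ Set.Icc (0 : ℝ) δ,
    ∃ x ∈ Set.Icc (h ^ 2 / (1 + h ^ 2)) (1 / (1 + h ^ 2)),
      y = |f (x + h * phi x) - 2 * f x + f (x - h * phi x)|}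

/-- The usual first modulus of continuity on `[0,1]`. -/
noncomputable def omega1 (g : ℝ → ℝ) (δ : ℝ) : ℝ :=
  sSup {y : ℝ | ∃ x ∈ Set.Icc (0 : ℝ) 1, ∃ z ∈ Set.Icc (0 : ℝ) 1,
    |x - z| ≤ δ ∧ y = |g x - g z|}

/-- The usual second modulus of smoothness on `[0,1]`. -/
noncomputable def omega2 (g : ℝ → ℝ) (δ : ℝ) : ℝ :=
  sSup {y : ℝ | ∃ h : ℝ, 0 < h ∧ h ≤ δ ∧ ∃ x : ℝ, x ∈ Set.Icc (0 : ℝ) 1 ∧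
    x + 2 * h ∈ Set.Icc (0 : ℝ) 1 ∧ y = |g (x + 2 * h) - 2 * g (x + h) + g x|}


/-- Binomial expectation. -/
noncomputable def binE (n : ℕ) (x : ℝ) (g : ℕ → ℝ) : ℝ :=
  ∑ k ∈ Finset.range (n + 1), g k * ((n.choose k : ℝ) * x ^ k * (1 - x) ^ (n - k))

lemma binE_succ (n : ℕ) (x : ℝ) (g : ℕ → ℝ) :
    binE (n + 1) x g = (1 - x) * binE n x g + x * binE n x (fun k => g (k + 1)) := by
  unfold binE
  rw [Finset.sum_range_succ']
  have h1 : ∀ k ∈ Finset.range (n + 1),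
      g (k + 1) * (((n + 1).choose (k + 1) : ℝ) * x ^ (k + 1) * (1 - x) ^ (n + 1 - (k + 1)))
      = x * (g (k + 1) * ((n.choose k : ℝ) * x ^ k * (1 - x) ^ (n - k)))
        + g (k + 1) * ((n.choose (k + 1) : ℝ) * x ^ (k + 1) * (1 - x) ^ (n - k)) := by
    intro k _
    rw [Nat.choose_succ_succ, Nat.add_sub_add_right]
    push_cast
    ring
  rw [Finset.sum_congr rfl h1, Finset.sum_add_distrib, ← Finset.mul_sum]
  have h2 : (1 - x) * ∑ k ∈ Finset.range (n + 1), g k * ((n.choose k : ℝ) * x ^ k * (1 - x) ^ (n - k))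
      = ∑ k ∈ Finset.range (n + 1), g (k + 1) * ((n.choose (k + 1) : ℝ) * x ^ (k + 1) * (1 - x) ^ (n - k))
        + g 0 * (((n + 1).choose 0 : ℝ) * x ^ 0 * (1 - x) ^ (n + 1 - 0)) := by
    rw [Finset.sum_range_succ', mul_add, Finset.sum_range_succ (fun k => g (k + 1) * _)]
    rw [Finset.mul_sum]
    have h3 : ∀ k ∈ Finset.range n,
        (1 - x) * (g (k + 1) * ((n.choose (k + 1) : ℝ) * x ^ (k + 1) * (1 - x) ^ (n - (k + 1))))
        = g (k + 1) * ((n.choose (k + 1) : ℝ) * x ^ (k + 1) * (1 - x) ^ (n - k)) := by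
      intro k hk
      have hk' := Finset.mem_range.1 hk
      have : n - k = (n - (k + 1)) + 1 := by omega
      rw [this, pow_succ]
      ring
    rw [Finset.sum_congr rfl h3]
    simp [pow_succ]
    ring
  rw [h2]
  ring

lemma binE_add (n : ℕ) (x : ℝ) (g h : ℕ → ℝ) :
    binE n x (fun k => g k + h k) = binE n x g + binE n x h := by
  simp [binE, add_mul, Finset.sum_add_distrib]

lemma binE_mul (n : ℕ) (x c : ℝ) (g : ℕ → ℝ) :
    binE n x (fun k => c * g k) = c * binE n x g := by
  simp [binE, mul_assoc, Finset.mul_sum]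

lemma binE_mono (n : ℕ) (x : ℝ) (hx : x ∈ Icc (0 : ℝ) 1) (g h : ℕ → ℝ)
    (H : ∀ k ≤ n, |g k| ≤ h k) : |binE n x g| ≤ binE n x h := by
  unfold binE
  refine (Finset.abs_sum_le_sum_abs _ _).trans (Finset.sum_le_sum fun k hk => ?_)
  have h0 : 0 ≤ (n.choose k : ℝ) * x ^ k * (1 - x) ^ (n - k) := by
    have := sub_nonneg.2 hx.2
    have := hx.1
    positivity
  rw [abs_mul, abs_of_nonneg h0]
  exact mul_le_mul_of_nonneg_right (H k (Nat.lt_succ_iff.1 (Finset.mem_range.1 hk))) h0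

lemma binE_moments (n : ℕ) (x : ℝ) :
    binE n x (fun _ => 1) = 1 ∧ binE n x (fun k => (k : ℝ) - n * x) = 0 ∧
    binE n x (fun k => ((k : ℝ) - n * x) ^ 2) = n * (x * (1 - x)) ∧
    binE n x (fun k => ((k : ℝ) - n * x) ^ 3) = n * (x * (1 - x) * (1 - 2 * x)) ∧
    binE n x (fun k => ((k : ℝ) - n * x) ^ 4) =
      3 * n ^ 2 * (x * (1 - x)) ^ 2 + n * (x * (1 - x) * (1 - 6 * (x * (1 - x)))) := by
  induction n with
  | zero => simp [binE]
  | succ n ih =>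
    obtain ⟨e0, e1, e2, e3, e4⟩ := ih
    have key : ∀ c a0 a1 a2 a3 a4 : ℝ, ∀ g : ℕ → ℝ,
        (∀ k : ℕ, g k = a0 * 1 + (a1 * ((k : ℝ) - n * x) + (a2 * ((k : ℝ) - n * x) ^ 2
          + (a3 * ((k : ℝ) - n * x) ^ 3 + a4 * ((k : ℝ) - n * x) ^ 4)))) →
        binE n x g = a0 + a2 * (n * (x * (1 - x))) + a3 * (n * (x * (1 - x) * (1 - 2 * x)))
          + a4 * (3 * n ^ 2 * (x * (1 - x)) ^ 2 + n * (x * (1 - x) * (1 - 6 * (x * (1 - x))))) := by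
      intro c a0 a1 a2 a3 a4 g hg
      rw [funext hg, binE_add, binE_add, binE_add, binE_add, binE_mul, binE_mul, binE_mul,
        binE_mul, binE_mul, e0, e1, e2, e3, e4]
      ring
    refine ⟨?_, ?_, ?_, ?_, ?_⟩
    · rw [binE_succ, e0]; ring
    · rw [binE_succ, key 0 (-x) 1 0 0 0 (fun k => (k : ℝ) - (n + 1 : ℕ) * x)
          (by intro k; push_cast; ring),
        key 0 (1 - x) 1 0 0 0 (fun k => ((k + 1 : ℕ) : ℝ) - (n + 1 : ℕ) * x)
          (by intro k; push_cast; ring)]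
      push_cast; ring
    · rw [binE_succ, key 0 (x ^ 2) (-2 * x) 1 0 0 (fun k => ((k : ℝ) - (n + 1 : ℕ) * x) ^ 2)
          (by intro k; push_cast; ring),
        key 0 ((1 - x) ^ 2) (2 * (1 - x)) 1 0 0
          (fun k => (((k + 1 : ℕ) : ℝ) - (n + 1 : ℕ) * x) ^ 2)
          (by intro k; push_cast; ring)]
      push_cast; ring
    · rw [binE_succ, key 0 (-x ^ 3) (3 * x ^ 2) (-3 * x) 1 0
          (fun k => ((k : ℝ) - (n + 1 : ℕ) * x) ^ 3)
          (by intro k; push_cast; ring),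
        key 0 ((1 - x) ^ 3) (3 * (1 - x) ^ 2) (3 * (1 - x)) 1 0
          (fun k => (((k + 1 : ℕ) : ℝ) - (n + 1 : ℕ) * x) ^ 3)
          (by intro k; push_cast; ring)]
      push_cast; ring
    · rw [binE_succ, key 0 (x ^ 4) (-4 * x ^ 3) (6 * x ^ 2) (-4 * x) 1
          (fun k => ((k : ℝ) - (n + 1 : ℕ) * x) ^ 4)
          (by intro k; push_cast; ring),
        key 0 ((1 - x) ^ 4) (4 * (1 - x) ^ 3) (6 * (1 - x) ^ 2) (4 * (1 - x)) 1
          (fun k => (((k + 1 : ℕ) : ℝ) - (n + 1 : ℕ) * x) ^ 4)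
          (by intro k; push_cast; ring)]
      push_cast; ring

/-- Lagrange form of the second order Taylor remainder, expansion point on either side. -/
lemma taylor_two (f f1 g : ℝ → ℝ)
    (h1 : ∀ u ∈ Icc (0 : ℝ) 1, HasDerivWithinAt f (f1 u) (Icc 0 1) u)
    (h2 : ∀ u ∈ Icc (0 : ℝ) 1, HasDerivWithinAt f1 (g u) (Icc 0 1) u)
    (x t : ℝ) (hx : x ∈ Icc (0 : ℝ) 1) (ht : t ∈ Icc (0 : ℝ) 1) :
    ∃ ξ ∈ Icc (0 : ℝ) 1, |ξ - x| ≤ |t - x| ∧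
      f t = f x + f1 x * (t - x) + g ξ / 2 * (t - x) ^ 2 := by
  rcases eq_or_ne x t with rfl | hne
  · exact ⟨x, hx, by simp, by simp⟩
  have hne' : t - x ≠ 0 := sub_ne_zero.2 hne.symm
  set K : ℝ := (f t - f x - f1 x * (t - x)) / (t - x) ^ 2 with hK
  have hK' : K * (t - x) ^ 2 = f t - f x - f1 x * (t - x) := by
    rw [hK]; field_simp
  let P : ℝ → ℝ := fun u => f t - f u - f1 u * (t - u) - K * (t - u) ^ 2
  have hPx : P x = 0 := by simp only [P]; linarith
  have hPt : P t = 0 := by simp [P]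
  have hPd : ∀ u ∈ Icc (0 : ℝ) 1, HasDerivWithinAt P
      ((2 * K - g u) * (t - u)) (Icc 0 1) u := by
    intro u hu
    have hid : HasDerivWithinAt (fun u : ℝ => t - u) (-1) (Icc 0 1) u :=
      (hasDerivWithinAt_id u _).const_sub t
    have := (((h1 u hu).const_sub (f t)).sub ((h2 u hu).mul hid)).sub ((hid.pow 2).const_mul K)
    refine this.congr_deriv ?_
    norm_num
    ring
  have hR : ∀ a b : ℝ, a ∈ Icc (0 : ℝ) 1 → b ∈ Icc (0 : ℝ) 1 → a < b → P a = P b →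
      ∃ ξ ∈ Ioo a b, (2 * K - g ξ) * (t - ξ) = 0 := by
    intro a b ha hb hab hP
    have hsub : Icc a b ⊆ Icc (0 : ℝ) 1 := Icc_subset_Icc ha.1 hb.2
    refine exists_hasDerivAt_eq_zero (f := P) hab
      (fun u hu => ((hPd u (hsub hu)).continuousWithinAt).mono hsub) hP ?_
    intro u hu
    exact (hPd u (hsub (Ioo_subset_Icc_self hu))).hasDerivAt
      (Icc_mem_nhds (ha.1.trans_lt hu.1) (hu.2.trans_le hb.2))
  rcases lt_or_gt_of_ne hne with h | h
  · obtain ⟨ξ, hξ, he⟩ := hR x t hx ht h (hPx.trans hPt.symm)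
    refine ⟨ξ, ⟨hx.1.trans hξ.1.le, hξ.2.le.trans ht.2⟩, ?_, ?_⟩
    · rw [abs_of_pos (sub_pos.2 hξ.1), abs_of_pos (sub_pos.2 h)]; linarith [hξ.2]
    · have : 2 * K - g ξ = 0 := (mul_eq_zero.1 he).resolve_right (by linarith [hξ.2])
      have e : g ξ / 2 = K := by linarith
      rw [e, hK']; ring
  · obtain ⟨ξ, hξ, he⟩ := hR t x ht hx h (hPt.trans hPx.symm)
    refine ⟨ξ, ⟨ht.1.trans hξ.1.le, hξ.2.le.trans hx.2⟩, ?_, ?_⟩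
    · rw [abs_of_neg (sub_neg.2 hξ.2), abs_of_neg (sub_neg.2 h)]; linarith [hξ.1]
    · have : 2 * K - g ξ = 0 := (mul_eq_zero.1 he).resolve_right
        (by intro h0; linarith [hξ.1])
      have e : g ξ / 2 = K := by linarith
      rw [e, hK']; ring

lemma omega1_bdd (g : ℝ → ℝ) (hg : ContinuousOn g (Icc 0 1)) (δ : ℝ) :
    BddAbove {y : ℝ | ∃ x ∈ Set.Icc (0 : ℝ) 1, ∃ z ∈ Set.Icc (0 : ℝ) 1,
      |x - z| ≤ δ ∧ y = |g x - g z|} := by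
  obtain ⟨C, hC⟩ := isCompact_Icc.exists_bound_of_continuousOn hg
  refine ⟨C + C, ?_⟩
  rintro y ⟨x, hx, z, hz, -, rfl⟩
  have a := hC x hx
  have b := hC z hz
  rw [Real.norm_eq_abs] at a b
  exact (abs_sub _ _).trans (add_le_add a b)

lemma omega1_nonneg (g : ℝ → ℝ) (δ : ℝ) : 0 ≤ omega1 g δ := by
  refine Real.sSup_nonneg ?_
  rintro y ⟨x, hx, z, hz, -, rfl⟩
  exact abs_nonneg _

lemma omega2_nonneg (g : ℝ → ℝ) (δ : ℝ) : 0 ≤ omega2 g δ := by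
  refine Real.sSup_nonneg ?_
  rintro y ⟨h, _, _, x, _, _, rfl⟩
  exact abs_nonneg _

lemma omega1_nat (g : ℝ → ℝ) (hg : ContinuousOn g (Icc 0 1)) (δ : ℝ) (x : ℝ)
    (hx : x ∈ Icc (0 : ℝ) 1) (N : ℕ) : ∀ u ∈ Icc (0 : ℝ) 1, |u - x| ≤ N * δ →
      |g u - g x| ≤ N * omega1 g δ := by
  induction N with
  | zero =>
    intro u hu h
    have : u = x := by
      have : |u - x| ≤ 0 := by simpa using h
      exact sub_eq_zero.1 (abs_nonpos_iff.1 this)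
    simp [this]
  | succ N ih =>
    intro u hu h
    have hN : (0 : ℝ) < N + 1 := by positivity
    set s : ℝ := N / (N + 1) with hs
    have hs0 : 0 ≤ s := by positivity
    have hs1 : s ≤ 1 := by rw [hs, div_le_one hN]; linarith
    have hsN : s * (N + 1) = N := by rw [hs]; field_simp
    push_cast at h ⊢
    have hv : x + s * (u - x) ∈ Icc (0 : ℝ) 1 := by
      obtain ⟨a, b⟩ := hx
      obtain ⟨c, d⟩ := hu
      constructor <;> nlinarith [mul_nonneg hs0 c, mul_nonneg (sub_nonneg.2 hs1) a,
        mul_nonneg hs0 (sub_nonneg.2 d), mul_nonneg (sub_nonneg.2 hs1) (sub_nonneg.2 b)]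
    have i1 := ih _ hv (by
      rw [add_sub_cancel_left, abs_mul, abs_of_nonneg hs0]
      calc s * |u - x| ≤ s * ((N + 1) * δ) := mul_le_mul_of_nonneg_left h hs0
        _ = N * δ := by rw [← mul_assoc, hsN])
    have i2 : |g u - g (x + s * (u - x))| ≤ omega1 g δ := by
      refine le_csSup (omega1_bdd g hg δ) ⟨u, hu, _, hv, ?_, rfl⟩
      have : u - (x + s * (u - x)) = (1 - s) * (u - x) := by ring
      rw [this, abs_mul, abs_of_nonneg (sub_nonneg.2 hs1)]
      calc (1 - s) * |u - x| ≤ (1 - s) * ((N + 1) * δ) :=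
            mul_le_mul_of_nonneg_left h (sub_nonneg.2 hs1)
        _ = ((N + 1) - s * (N + 1)) * δ := by ring
        _ = δ := by rw [hsN]; ring
    have := abs_sub_le (g u) (g (x + s * (u - x))) (g x)
    linarith

lemma omega1_sq (g : ℝ → ℝ) (hg : ContinuousOn g (Icc 0 1)) (n : ℕ) (hn : 2 ≤ n) (x u d : ℝ)
    (hx : x ∈ Icc (0 : ℝ) 1) (hu : u ∈ Icc (0 : ℝ) 1) (hd : |u - x| ≤ |d|) :
    |g u - g x| ≤ (1 + n * d ^ 2) * omega1 g (1 / Real.sqrt n) := by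
  have hn0 : (0 : ℝ) < n := by exact_mod_cast (by omega : 0 < n)
  have hsq : 0 < Real.sqrt n := Real.sqrt_pos.2 hn0
  set r := |d| * Real.sqrt n with hr
  have hr0 : 0 ≤ r := by positivity
  have h1 := omega1_nat g hg (1 / Real.sqrt n) x hx ⌈r⌉₊ u hu (by
    have h := Nat.le_ceil r
    rw [mul_one_div, le_div_iff₀ hsq]
    exact (mul_le_mul_of_nonneg_right hd hsq.le).trans h)
  refine h1.trans (mul_le_mul_of_nonneg_right ?_ (omega1_nonneg _ _))
  have hr2 : r ^ 2 = n * d ^ 2 := by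
    rw [hr, mul_pow, sq_abs, Real.sq_sqrt hn0.le]; ring
  rw [← hr2]
  rcases le_or_gt r 1 with h | h
  · have : ⌈r⌉₊ ≤ 1 := Nat.ceil_le.2 (by simpa using h)
    have : (⌈r⌉₊ : ℝ) ≤ 1 := by exact_mod_cast this
    nlinarith
  · have := Nat.ceil_lt_add_one hr0
    nlinarith

/-- **Theorem 4.** If `f ∈ C²[0,1]`, then for all `n ≥ 2`,
`‖B_n f - f - (1/(2n))φ²f''‖ ≤ (5/(8n))ω₁(f'',1/√n) + (13/(64n))ω₂(f'',1/√n)`. -/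
theorem voronovskaja_norm_estimate_moduli
    (f : ℝ → ℝ) (hf : ContDiffOn ℝ 2 f (Set.Icc 0 1)) :
    ∀ n : ℕ, 2 ≤ n →
      supNorm (fun x => bern n f x - f x -
          1 / (2 * n) * phi x ^ 2 * iteratedDerivWithin 2 f (Set.Icc 0 1) x) ≤
        5 / (8 * n) * omega1 (iteratedDerivWithin 2 f (Set.Icc 0 1)) (1 / Real.sqrt n) +
          13 / (64 * n) * omega2 (iteratedDerivWithin 2 f (Set.Icc 0 1)) (1 / Real.sqrt n) := by
  intro n hn
  have hU : UniqueDiffOn ℝ (Icc (0 : ℝ) 1) := uniqueDiffOn_Icc zero_lt_one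
  have hg : ContinuousOn (iteratedDerivWithin 2 f (Icc 0 1)) (Icc 0 1) :=
    hf.continuousOn_iteratedDerivWithin le_rfl hU
  have h1 : ∀ u ∈ Icc (0 : ℝ) 1,
      HasDerivWithinAt f (iteratedDerivWithin 1 f (Icc 0 1) u) (Icc 0 1) u := by
    intro u hu
    rw [iteratedDerivWithin_one]
    exact (hf.differentiableOn (by norm_num) u hu).hasDerivWithinAt
  have h2 : ∀ u ∈ Icc (0 : ℝ) 1, HasDerivWithinAt (iteratedDerivWithin 1 f (Icc 0 1))
      (iteratedDerivWithin 2 f (Icc 0 1) u) (Icc 0 1) u := by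
    intro u hu
    rw [iteratedDerivWithin_succ (n := 1)]
    exact (hf.differentiableOn_iteratedDerivWithin (m := 1) (by norm_num) hU u hu).hasDerivWithinAt
  set g := iteratedDerivWithin 2 f (Icc 0 1) with hgdef
  set f1 := iteratedDerivWithin 1 f (Icc 0 1) with hf1def
  set w := omega1 g (1 / Real.sqrt n) with hw
  have hw0 : 0 ≤ w := omega1_nonneg _ _
  have hn0 : (0 : ℝ) < n := by exact_mod_cast (by omega : 0 < n)
  have hn2 : (2 : ℝ) ≤ n := by exact_mod_cast hn
  have hω2 : 0 ≤ 13 / (64 * (n : ℝ)) * omega2 g (1 / Real.sqrt n) :=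
    mul_nonneg (by positivity) (omega2_nonneg _ _)
  refine csSup_le (Set.Nonempty.image _ ⟨0, by simp⟩) ?_
  rintro _ ⟨x, hx, rfl⟩
  refine le_trans ?_ (le_add_of_nonneg_right hω2)
  have hX0 : 0 ≤ x * (1 - x) := mul_nonneg hx.1 (sub_nonneg.2 hx.2)
  have hX1 : x * (1 - x) ≤ 1 / 4 := by nlinarith [sq_nonneg (x - 1 / 2)]
  have hphi : phi x ^ 2 = x * (1 - x) := Real.sq_sqrt hX0
  obtain ⟨e0, e1, e2, -, e4⟩ := binE_moments n x
  let R : ℕ → ℝ := fun k => f ((k : ℝ) / n) - f x - f1 x * ((k : ℝ) / n - x)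
    - g x / 2 * ((k : ℝ) / n - x) ^ 2
  have hbern : bern n f x = binE n x (fun k => f ((k : ℝ) / n)) := by
    unfold bern binE
    exact Finset.sum_congr rfl fun k _ => by ring
  have hdec : (fun k : ℕ => f ((k : ℝ) / n)) = fun k : ℕ => R k + (f x * 1 +
      (f1 x / n * ((k : ℝ) - n * x) + g x / (2 * n ^ 2) * ((k : ℝ) - n * x) ^ 2)) := by
    funext k
    simp only [R]
    field_simp
    ring
  have hmain : bern n f x - f x - 1 / (2 * n) * phi x ^ 2 * g x = binE n x R := by
    rw [hbern, hdec, binE_add, binE_add, binE_add, binE_mul, binE_mul, binE_mul, e0, e1, e2, hphi]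
    field_simp
    ring
  have hRb : ∀ k ≤ n, |R k| ≤ w / (2 * n ^ 2) * ((k : ℝ) - n * x) ^ 2
      + w / (2 * n ^ 3) * ((k : ℝ) - n * x) ^ 4 := by
    intro k hk
    have ht : (k : ℝ) / n ∈ Icc (0 : ℝ) 1 :=
      ⟨by positivity, (div_le_one hn0).2 (by exact_mod_cast hk)⟩
    obtain ⟨ξ, hξ, hd, he⟩ := taylor_two f f1 g h1 h2 x _ hx ht
    have hb := omega1_sq g hg n hn x ξ _ hx hξ hd
    have hR : R k = (g ξ - g x) * (((k : ℝ) / n - x) ^ 2 / 2) := by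
      simp only [R]; rw [he]; ring
    rw [hR, abs_mul, abs_of_nonneg (by positivity : 0 ≤ ((k : ℝ) / n - x) ^ 2 / 2)]
    refine (mul_le_mul_of_nonneg_right hb (by positivity)).trans (le_of_eq ?_)
    rw [← hw]
    field_simp
  have hfin := binE_mono n x hx R _ hRb
  rw [binE_add, binE_mul, binE_mul, e2, e4] at hfin
  change |bern n f x - f x - 1 / (2 * n) * phi x ^ 2 * g x| ≤ _
  rw [hmain]
  refine hfin.trans ?_
  set X := x * (1 - x) with hX
  have : w / (2 * (n : ℝ) ^ 2) * (n * X) + w / (2 * (n : ℝ) ^ 3) * (3 * n ^ 2 * X ^ 2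
      + n * (X * (1 - 6 * X))) = w / n * (X / 2 + 3 / 2 * X ^ 2 + X * (1 - 6 * X) * (1 / n) / 2) := by
    field_simp
    ring
  rw [this]
  have h5 : 5 / (8 * (n : ℝ)) * w = w / n * (5 / 8) := by field_simp
  rw [h5]
  refine mul_le_mul_of_nonneg_left ?_ (by positivity)
  have hi : 1 / (n : ℝ) ≤ 1 / 2 := one_div_le_one_div_of_le (by norm_num) hn2
  have hi0 : 0 < 1 / (n : ℝ) := by positivity
  have a1 : X * (1 - 6 * X) ≤ 1 / 4 := by nlinarith
  have a2 : X * (1 - 6 * X) * (1 / n) ≤ 1 / 4 * (1 / n) := mul_le_mul_of_nonneg_right a1 hi0.le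
  nlinarith
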